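/- If α ∈ ℝ and (s_j)_{j=0}^{κ} belongs to the class K^{≥}_{q,κ,α} of α-Stieltjes right-nonnegative definite sequences, then its first α-Schur transform (s_j^{[1,α]})_{j=0}^{κ−1}, defined by s_j^{[1,α]} := s_0 (−s_{j+1}^{♯,α}) s_0, belongs to K^{≥}_{q,κ−1,α}. -/

import Mathlib

open Matrix BigOperators ComplexOrder

def IsMP {m n : Type*} [Fintype m] [Fintype n] (A : Matrix m n ℂ) (B : Matrix n m ℂ) : Prop :=
  A * B * A = A ∧ B * A * B = B ∧ (A * B)ᴴ = A * B ∧ (B * A)ᴴ = B * A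

open Classical in
noncomputable def mp {m n : Type*} [Fintype m] [Fintype n] (A : Matrix m n ℂ) : Matrix n m ℂ :=
  if h : ∃ B, IsMP A B then h.choose else 0

noncomputable def recip {p q : ℕ} (s : ℕ → Matrix (Fin p) (Fin q) ℂ) :
    ℕ → Matrix (Fin q) (Fin p) ℂ
  | 0 => mp (s 0)
  | (j+1) => -(mp (s 0) * ∑ l : Fin (j+1), s (j+1 - l.val) * recip s l.val)
termination_by j => j
decreasing_by exact l.isLt

noncomputable def shiftA {p q : ℕ} (α : ℂ) (s : ℕ → Matrix (Fin p) (Fin q) ℂ) :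
    ℕ → Matrix (Fin p) (Fin q) ℂ
  | 0 => s 0
  | (j+1) => (-α) • s j + s (j+1)

noncomputable def recipA {p q : ℕ} (α : ℂ) (s : ℕ → Matrix (Fin p) (Fin q) ℂ) :
    ℕ → Matrix (Fin q) (Fin p) ℂ :=
  recip (shiftA α s)

/-- the first α-Schur transform. -/
noncomputable def schur1 {p q : ℕ} (α : ℂ) (s : ℕ → Matrix (Fin p) (Fin q) ℂ) :
    ℕ → Matrix (Fin p) (Fin q) ℂ :=
  fun j => s 0 * (-(recipA α s (j + 1))) * s 0

/-- block Hankel matrix H_n = [s_{j+k}]_{j,k=0}^{n}. -/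
def hankelMat {p q : ℕ} (s : ℕ → Matrix (Fin p) (Fin q) ℂ) (n : ℕ) :
    Matrix (Fin (n + 1) × Fin p) (Fin (n + 1) × Fin q) ℂ :=
  Matrix.of fun jk lm => s (jk.1.val + lm.1.val) jk.2 lm.2

/-- block Hankel matrix K_n = [s_{j+k+1}]_{j,k=0}^{n}. -/
def hankelKMat {p q : ℕ} (s : ℕ → Matrix (Fin p) (Fin q) ℂ) (n : ℕ) :
    Matrix (Fin (n + 1) × Fin p) (Fin (n + 1) × Fin q) ℂ :=
  Matrix.of fun jk lm => s (jk.1.val + lm.1.val + 1) jk.2 lm.2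

/-- the class K^{≥}_{q,κ,α} of α-Stieltjes right-nonnegative definite sequences. -/
def Kgg {q : ℕ} (α : ℝ) (κ : ℕ∞) (s : ℕ → Matrix (Fin q) (Fin q) ℂ) : Prop :=
  (∀ n : ℕ, ((2 * n : ℕ) : ℕ∞) ≤ κ → (hankelMat s n).PosSemidef) ∧
  (∀ n : ℕ, ((2 * n + 1 : ℕ) : ℕ∞) ≤ κ →
    ((-(α : ℂ)) • hankelMat s n + hankelKMat s n).PosSemidef)

theorem exists_isMP_of_isHermitian {n : Type*} [Fintype n] {A : Matrix n n ℂ}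
    (hA : A.IsHermitian) : ∃ B, IsMP A B := by
  classical
  set U : Matrix n n ℂ := (hA.eigenvectorUnitary : Matrix n n ℂ)
  set d : n → ℂ := fun i => (hA.eigenvalues i : ℂ)
  have hU : Uᴴ * U = 1 := Unitary.coe_star_mul_self hA.eigenvectorUnitary
  have hspec : A = U * diagonal d * Uᴴ := by
    have h := hA.spectral_theorem
    rw [Unitary.conjStarAlgAut_apply] at h
    exact h
  have hAB : A * (U * diagonal d⁻¹ * Uᴴ) = U * diagonal (d * d⁻¹) * Uᴴ := by
    rw [hspec]
    calc _ = U * diagonal d * (Uᴴ * U) * diagonal d⁻¹ * Uᴴ := by simp only [Matrix.mul_assoc]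
      _ = U * (diagonal d * diagonal d⁻¹) * Uᴴ := by
          rw [hU, Matrix.mul_one]; simp only [Matrix.mul_assoc]
      _ = _ := by rw [diagonal_mul_diagonal']; rfl
  have hBA : (U * diagonal d⁻¹ * Uᴴ) * A = U * diagonal (d * d⁻¹) * Uᴴ := by
    rw [hspec]
    calc _ = U * diagonal d⁻¹ * (Uᴴ * U) * diagonal d * Uᴴ := by simp only [Matrix.mul_assoc]
      _ = U * (diagonal d⁻¹ * diagonal d) * Uᴴ := by
          rw [hU, Matrix.mul_one]; simp only [Matrix.mul_assoc]
      _ = _ := by rw [diagonal_mul_diagonal', ← mul_comm d⁻¹ d]; rfl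
  have hherm : (U * diagonal (d * d⁻¹) * Uᴴ)ᴴ = U * diagonal (d * d⁻¹) * Uᴴ := by
    have hd : star (d * d⁻¹) = d * d⁻¹ := by
      ext i
      by_cases h : hA.eigenvalues i = 0 <;> simp [d, h]
    rw [conjTranspose_mul, conjTranspose_mul, diagonal_conjTranspose, hd,
      conjTranspose_conjTranspose, Matrix.mul_assoc]
  refine ⟨U * diagonal d⁻¹ * Uᴴ, ?_, ?_, ?_, ?_⟩
  · rw [hAB, hspec]
    calc _ = U * diagonal (d * d⁻¹) * (Uᴴ * U) * diagonal d * Uᴴ := by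
          simp only [Matrix.mul_assoc]
      _ = U * (diagonal (d * d⁻¹) * diagonal d) * Uᴴ := by
          rw [hU, Matrix.mul_one]; simp only [Matrix.mul_assoc]
      _ = _ := by
          rw [diagonal_mul_diagonal']
          congr 3
          ext i
          by_cases h : d i = 0 <;> simp [h]
  · rw [hBA]
    calc _ = U * diagonal (d * d⁻¹) * (Uᴴ * U) * diagonal d⁻¹ * Uᴴ := by
          simp only [Matrix.mul_assoc]
      _ = U * (diagonal (d * d⁻¹) * diagonal d⁻¹) * Uᴴ := by
          rw [hU, Matrix.mul_one]; simp only [Matrix.mul_assoc]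
      _ = _ := by
          rw [diagonal_mul_diagonal']
          congr 3
          ext i
          by_cases h : d i = 0 <;> simp [h]
  · rw [hAB, hherm]
  · rw [hBA, hherm]

theorem isMP_mp_of_isHermitian {n : Type*} [Fintype n] {A : Matrix n n ℂ}
    (hA : A.IsHermitian) : IsMP A (mp A) := by
  have h := exists_isMP_of_isHermitian hA
  rw [mp, dif_pos h]
  exact h.choose_spec

theorem IsMP.commute_of_isHermitian {n : Type*} [Fintype n] {A B : Matrix n n ℂ}
    (h : IsMP A B) (hA : A.IsHermitian) : A * B = B * A := by
  obtain ⟨h1, -, h3, h4⟩ := h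
  rw [conjTranspose_mul, hA.eq] at h3 h4
  calc A * B = Bᴴ * A := h3.symm
    _ = Bᴴ * (A * B * A) := by rw [h1]
    _ = Bᴴ * A * (B * A) := by simp only [Matrix.mul_assoc]
    _ = A * B * (A * Bᴴ) := by rw [h3, h4]
    _ = A * B * A * Bᴴ := by simp only [Matrix.mul_assoc]
    _ = B * A := by rw [h1, h4]

section Convolution

variable {R : Type*} [Ring R] {f W : ℕ → R} {P : R}

theorem sum_mul_mul_of_left_inverse
    (hL : ∀ n, ∑ c ∈ Finset.range (n + 1), W (n - c) * f c = if n = 0 then P else 0)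
    (j k : ℕ) :
    ∑ a ∈ Finset.range (j + 1), ∑ e ∈ Finset.range (a + 1),
      W (j - a) * f (a - e) * W (k + 1 + e) = P * W (k + 1 + j) := by
  have h := Finset.sum_range_diag_flip (j + 1)
    (fun e c => W (j - (e + c)) * f c * W (k + 1 + e))
  have h1 : ∑ a ∈ Finset.range (j + 1), ∑ e ∈ Finset.range (a + 1),
      W (j - a) * f (a - e) * W (k + 1 + e) =
      ∑ a ∈ Finset.range (j + 1), ∑ e ∈ Finset.range (a + 1),
      W (j - (e + (a - e))) * f (a - e) * W (k + 1 + e) := by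
    refine Finset.sum_congr rfl fun a _ => Finset.sum_congr rfl fun e he => ?_
    rw [Finset.mem_range] at he
    rw [show e + (a - e) = a by omega]
  rw [h1, h, Finset.sum_range_succ, Finset.sum_eq_zero, zero_add, ← Finset.sum_mul]
  · have := hL 0
    simp only [zero_add, if_true] at this
    simpa using congrArg (· * W (k + 1 + j)) this
  · intro e he
    rw [Finset.mem_range] at he
    have := hL (j - e)
    rw [if_neg (by omega), show j - e + 1 = j + 1 - e by omega] at this
    rw [← Finset.sum_mul]
    simp only [← Nat.sub_sub, this, zero_mul]

theorem sum_shift_of_right_inverse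
    (hR : ∀ n, ∑ i ∈ Finset.range (n + 1), f (n - i) * W i = if n = 0 then P else 0)
    (a k : ℕ) :
    ∑ i ∈ Finset.range (k + 1), f (a + 1 + (k - i)) * W i =
      -∑ e ∈ Finset.range (a + 1), f (a - e) * W (k + 1 + e) := by
  have h := hR (a + k + 1)
  rw [if_neg (by omega), show a + k + 1 + 1 = (k + 1) + (a + 1) by omega,
    Finset.sum_range_add] at h
  rw [eq_neg_iff_add_eq_zero, ← h]
  congr 1
  · refine Finset.sum_congr rfl fun i hi => ?_
    rw [Finset.mem_range] at hi
    congr 2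
    omega
  · refine Finset.sum_congr rfl fun i hi => ?_
    congr 2
    omega

theorem sum_hankel_succ
    (hL : ∀ n, ∑ c ∈ Finset.range (n + 1), W (n - c) * f c = if n = 0 then P else 0)
    (hR : ∀ n, ∑ i ∈ Finset.range (n + 1), f (n - i) * W i = if n = 0 then P else 0)
    (j k : ℕ) :
    ∑ a ∈ Finset.range (j + 1), ∑ b ∈ Finset.range (k + 1),
      W (j - a) * f (a + b + 1) * W (k - b) = -(P * W (j + k + 1)) := by
  have h : ∀ a, ∑ b ∈ Finset.range (k + 1), W (j - a) * f (a + b + 1) * W (k - b) =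
      -∑ e ∈ Finset.range (a + 1), W (j - a) * f (a - e) * W (k + 1 + e) := by
    intro a
    simp only [mul_assoc, ← Finset.mul_sum, ← mul_neg]
    rw [← sum_shift_of_right_inverse hR a k, ← Finset.sum_range_reflect]
    congr 1
    refine Finset.sum_congr rfl fun i hi => ?_
    rw [Finset.mem_range] at hi
    rw [show k + 1 - 1 - i = k - i by omega, show k - (k - i) = i by omega,
      show a + (k - i) + 1 = a + 1 + (k - i) by omega]
  simp only [h, Finset.sum_neg_distrib]
  rw [sum_mul_mul_of_left_inverse hL, show k + 1 + j = j + k + 1 by omega]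

theorem sum_hankel
    (hL : ∀ n, ∑ c ∈ Finset.range (n + 1), W (n - c) * f c = if n = 0 then P else 0)
    (hR : ∀ n, ∑ i ∈ Finset.range (n + 1), f (n - i) * W i = if n = 0 then P else 0)
    (j k : ℕ) :
    ∑ a ∈ Finset.range (j + 2), ∑ b ∈ Finset.range (k + 2),
      W (j + 1 - a) * f (a + b) * W (k + 1 - b) = -(P * W (j + k + 2)) := by
  have hrefl : ∀ a, ∑ b ∈ Finset.range (k + 2), W (j + 1 - a) * f (a + b) * W (k + 1 - b) =
      W (j + 1 - a) * ∑ i ∈ Finset.range (k + 2), f (a + (k + 1 - i)) * W i := by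
    intro a
    rw [← Finset.sum_range_reflect, Finset.mul_sum]
    refine Finset.sum_congr rfl fun i hi => ?_
    rw [Finset.mem_range] at hi
    rw [show k + 2 - 1 - i = k + 1 - i by omega, show k + 1 - (k + 1 - i) = i by omega, mul_assoc]
  simp only [hrefl]
  rw [Finset.sum_range_succ']
  have h0 := hR (k + 1)
  rw [if_neg (by omega)] at h0
  simp only [zero_add, h0, mul_zero, add_zero]
  simp only [sum_shift_of_right_inverse hR, mul_neg, Finset.sum_neg_distrib, Finset.mul_sum,
    ← mul_assoc, Nat.add_sub_add_right]
  rw [sum_mul_mul_of_left_inverse hL, show k + 1 + 1 + j = j + k + 2 by omega]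

end Convolution

theorem posSemidef_block_congr {m n p r : Type*} [Fintype m] [Fintype n] [Fintype p] [Fintype r]
    {M : m → m → Matrix p p ℂ}
    (hM : (Matrix.of fun x y : m × p => M x.1 y.1 x.2 y.2).PosSemidef)
    (C : n → m → Matrix r p ℂ) :
    (Matrix.of fun x y : n × r =>
      (∑ a, ∑ b, C x.1 a * M a b * (C y.1 b)ᴴ) x.2 y.2).PosSemidef := by
  convert hM.mul_mul_conjTranspose_same
    (Matrix.of fun (x : n × r) (y : m × p) => C x.1 y.1 x.2 y.2) using 1
  ext x y
  simp only [Matrix.of_apply, Matrix.mul_apply, Matrix.sum_apply, Fintype.sum_prod_type,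
    Matrix.conjTranspose_apply, Finset.sum_mul]
  rw [Finset.sum_comm]
  refine Finset.sum_congr rfl fun b _ => ?_
  rw [Finset.sum_comm]

/-- The block Hankel form of the sequence `g` is carried to the block form with entries
`Z (j - a) * g (a + b) * Z (k - b)` summed over `a ≤ j`, `b ≤ k`, read off from the row `d` on. -/
theorem posSemidef_toeplitz_congr {q : ℕ} {g Z : ℕ → Matrix (Fin q) (Fin q) ℂ} {n d : ℕ}
    (hg : (hankelMat g (n + d)).PosSemidef) :
    (Matrix.of fun x y : Fin (n + 1) × Fin q =>
      (∑ a ∈ Finset.range (x.1.val + d + 1), ∑ b ∈ Finset.range (y.1.val + d + 1),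
        Z (x.1.val + d - a) * g (a + b) * (Z (y.1.val + d - b))ᴴ) x.2 y.2).PosSemidef := by
  have h := posSemidef_block_congr (M := fun a b : Fin (n + d + 1) => g (a.val + b.val)) hg
    (fun (j : Fin (n + 1)) (a : Fin (n + d + 1)) =>
      if a.val ≤ j.val + d then Z (j.val + d - a.val) else 0)
  convert h using 1
  ext x y
  simp only [Matrix.of_apply]
  refine Matrix.ext_iff.mpr ?_ _ _
  have key : ∀ (j : Fin (n + 1)) (F : ℕ → Matrix (Fin q) (Fin q) ℂ),
      ∑ a ∈ Finset.range (j.val + d + 1), F a =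
        ∑ a : Fin (n + d + 1), if a.val ≤ j.val + d then F a.val else 0 := by
    intro j F
    rw [Fin.sum_univ_eq_sum_range (fun a => if a ≤ j.val + d then F a else 0),
      ← Finset.sum_filter]
    refine Finset.sum_congr ?_ fun _ _ => rfl
    ext a
    have := j.isLt
    simp only [Finset.mem_range, Finset.mem_filter]
    omega
  rw [key]
  refine Finset.sum_congr rfl fun a _ => ?_
  split_ifs with ha
  · rw [key]
    refine Finset.sum_congr rfl fun b _ => ?_
    split_ifs with hb <;> simp
  · simp

section Recip

variable {q : ℕ} {t t' : ℕ → Matrix (Fin q) (Fin q) ℂ} {P : Matrix (Fin q) (Fin q) ℂ}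

theorem recip_succ (t : ℕ → Matrix (Fin q) (Fin q) ℂ) (j : ℕ) :
    recip t (j + 1) = -(mp (t 0) * ∑ l ∈ Finset.range (j + 1), t (j + 1 - l) * recip t l) := by
  rw [recip, Fin.sum_univ_eq_sum_range (fun l => t (j + 1 - l) * recip t l)]

theorem mul_recip (hP : P * mp (t 0) = mp (t 0)) (j : ℕ) : P * recip t j = recip t j := by
  cases j with
  | zero => rw [recip, hP]
  | succ j => rw [recip_succ, mul_neg, ← mul_assoc, hP]

theorem recip_mul (hP : mp (t 0) * P = mp (t 0)) (j : ℕ) : recip t j * P = recip t j := by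
  induction j using Nat.strong_induction_on with
  | _ j ih =>
    cases j with
    | zero => rw [recip, hP]
    | succ j =>
      rw [recip_succ, neg_mul, mul_assoc, Finset.sum_mul]
      congr 2
      refine Finset.sum_congr rfl fun l hl => ?_
      rw [mul_assoc, ih l (Finset.mem_range.1 hl)]

/-- The reciprocal sequence only sees the compressions of the terms by `P`. -/
theorem recip_congr_of_compress (hP : P * mp (t 0) = mp (t 0)) (hP' : mp (t 0) * P = mp (t 0))
    (h0 : t' 0 = t 0) {N : ℕ} (h : ∀ i ≤ N, t' i = P * t i * P) {j : ℕ} (hj : j ≤ N) :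
    recip t' j = recip t j := by
  induction j using Nat.strong_induction_on with
  | _ j ih =>
    cases j with
    | zero => rw [recip, recip, h0]
    | succ j =>
      rw [recip_succ, recip_succ, h0, Finset.mul_sum, Finset.mul_sum]
      congr 1
      refine Finset.sum_congr rfl fun l hl => ?_
      rw [Finset.mem_range] at hl
      rw [ih l hl (by omega), h _ (by omega)]
      calc mp (t 0) * (P * t (j + 1 - l) * P * recip t l)
          = mp (t 0) * P * t (j + 1 - l) * (P * recip t l) := by simp only [mul_assoc]
        _ = _ := by rw [hP', mul_recip hP, mul_assoc]

theorem mk_mul_mk_recip (ht : ∀ j, P * t j = t j) (hP : t 0 * mp (t 0) = P) :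
    PowerSeries.mk t * PowerSeries.mk (recip t) = PowerSeries.C P := by
  ext1 n
  rw [PowerSeries.coeff_mul, PowerSeries.coeff_C]
  simp only [PowerSeries.coeff_mk]
  rw [← Finset.Nat.sum_antidiagonal_swap]
  simp only [Prod.fst_swap, Prod.snd_swap]
  rw [Finset.Nat.sum_antidiagonal_eq_sum_range_succ (fun i j => t j * recip t i)]
  cases n with
  | zero => simp [recip, hP]
  | succ j =>
    rw [if_neg (by omega), Finset.sum_range_succ, recip_succ, Nat.sub_self, mul_neg, ← mul_assoc,
      hP, Finset.mul_sum]
    simp only [← mul_assoc, ht]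
    exact add_neg_cancel _

theorem mk_conjTranspose_mul_mk {W : ℕ → Matrix (Fin q) (Fin q) ℂ} (ht : ∀ j, (t j).IsHermitian)
    (hP : P.IsHermitian) (h : PowerSeries.mk t * PowerSeries.mk W = PowerSeries.C P) :
    PowerSeries.mk (fun j => (W j)ᴴ) * PowerSeries.mk t = PowerSeries.C P := by
  ext1 n
  have := congrArg (fun F => (PowerSeries.coeff n F)ᴴ) h
  simp only [PowerSeries.coeff_mul, PowerSeries.coeff_mk, PowerSeries.coeff_C,
    conjTranspose_sum, conjTranspose_mul, (ht _).eq] at this ⊢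
  rw [← Finset.Nat.sum_antidiagonal_swap]
  simp only [Prod.fst_swap, Prod.snd_swap, this]
  split_ifs <;> simp [hP.eq]

theorem mk_mul_mk_comm_of_isHermitian {W : ℕ → Matrix (Fin q) (Fin q) ℂ}
    (ht : ∀ j, (t j).IsHermitian) (hW : ∀ j, (W j).IsHermitian) (hP : P.IsHermitian)
    (h : PowerSeries.mk t * PowerSeries.mk W = PowerSeries.C P) :
    PowerSeries.mk W * PowerSeries.mk t = PowerSeries.C P := by
  simpa only [(hW _).eq] using mk_conjTranspose_mul_mk ht hP h

theorem isHermitian_of_mk_mul_mk {W : ℕ → Matrix (Fin q) (Fin q) ℂ} (ht : ∀ j, (t j).IsHermitian)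
    (hP : P.IsHermitian) (hPW : ∀ j, P * W j = W j)
    (h : PowerSeries.mk t * PowerSeries.mk W = PowerSeries.C P) (j : ℕ) : (W j).IsHermitian := by
  have h' := mk_conjTranspose_mul_mk ht hP h
  have hassoc : PowerSeries.mk (fun j => (W j)ᴴ) * PowerSeries.C P =
      PowerSeries.C P * PowerSeries.mk W := by
    rw [← h, ← mul_assoc, h', h]
  have := congrArg (PowerSeries.coeff j) hassoc
  rw [PowerSeries.coeff_mul_C, PowerSeries.coeff_C_mul, PowerSeries.coeff_mk,
    PowerSeries.coeff_mk, hPW] at this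
  have hWP : (W j)ᴴ * P = (W j)ᴴ := by
    nth_rw 1 [← hP.eq]
    rw [← conjTranspose_mul, hPW]
  rw [Matrix.IsHermitian, ← hWP, this]

theorem mk_shiftA (α : ℂ) (t : ℕ → Matrix (Fin q) (Fin q) ℂ) :
    PowerSeries.mk (shiftA α t) = PowerSeries.mk t - α • (PowerSeries.X * PowerSeries.mk t) := by
  ext1 n
  cases n with
  | zero => simp [shiftA]
  | succ n => simp [shiftA, PowerSeries.coeff_succ_X_mul, sub_eq_neg_add]

theorem mk_shiftA_mul (α : ℂ) (t W : ℕ → Matrix (Fin q) (Fin q) ℂ) :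
    PowerSeries.mk (shiftA α t) * PowerSeries.mk W =
      PowerSeries.mk t * PowerSeries.mk (shiftA α W) := by
  rw [mk_shiftA, mk_shiftA, sub_mul, mul_sub, smul_mul_assoc, mul_smul_comm, ← mul_assoc,
    (PowerSeries.commute_X (PowerSeries.mk t)).eq]

theorem shiftA_isHermitian {α : ℝ} (ht : ∀ j, (t j).IsHermitian) (j : ℕ) :
    (shiftA (α : ℂ) t j).IsHermitian := by
  cases j with
  | zero => exact ht 0
  | succ j =>
    simp only [Matrix.IsHermitian, shiftA, conjTranspose_add, conjTranspose_smul, (ht _).eq]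
    simp

theorem mul_shiftA (α : ℂ) (ht : ∀ j, P * t j = t j) (j : ℕ) :
    P * shiftA α t j = shiftA α t j := by
  cases j with
  | zero => exact ht 0
  | succ j => rw [shiftA, mul_add, mul_smul_comm, ht, ht]

theorem shiftA_mul (α : ℂ) (ht : ∀ j, t j * P = t j) (j : ℕ) :
    shiftA α t j * P = shiftA α t j := by
  cases j with
  | zero => exact ht 0
  | succ j => rw [shiftA, add_mul, smul_mul_assoc, ht, ht]

end Recip

theorem conv_left {R : Type*} [Ring R] {f W : ℕ → R} {P : R}
    (h : PowerSeries.mk W * PowerSeries.mk f = PowerSeries.C P) (n : ℕ) :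
    ∑ c ∈ Finset.range (n + 1), W (n - c) * f c = if n = 0 then P else 0 := by
  have := congrArg (PowerSeries.coeff n) h
  rw [PowerSeries.coeff_mul, PowerSeries.coeff_C, ← Finset.Nat.sum_antidiagonal_swap] at this
  simp only [PowerSeries.coeff_mk, Prod.fst_swap, Prod.snd_swap] at this
  rw [← this, Finset.Nat.sum_antidiagonal_eq_sum_range_succ (fun i j => W j * f i)]

theorem conv_right {R : Type*} [Ring R] {f W : ℕ → R} {P : R}
    (h : PowerSeries.mk f * PowerSeries.mk W = PowerSeries.C P) (n : ℕ) :
    ∑ i ∈ Finset.range (n + 1), f (n - i) * W i = if n = 0 then P else 0 :=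
  conv_left h n

theorem Kgg.isHermitian {q : ℕ} {α : ℝ} {κ : ℕ∞} {s : ℕ → Matrix (Fin q) (Fin q) ℂ}
    (hs : Kgg α κ s) {j : ℕ} (hj : (j : ℕ∞) ≤ κ) : (s j).IsHermitian := by
  have heven : ∀ n : ℕ, ((2 * n : ℕ) : ℕ∞) ≤ κ → (s (2 * n)).IsHermitian := by
    intro n hn
    ext x y
    have := (hs.1 n hn).isHermitian.apply (Fin.last n, x) (Fin.last n, y)
    simpa [hankelMat, two_mul] using this
  obtain ⟨n, rfl | rfl⟩ := Nat.even_or_odd' j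
  · exact heven n hj
  · have he := heven n (le_trans (by exact_mod_cast Nat.le_succ _) hj)
    ext x y
    have h1 := (hs.2 n hj).isHermitian.apply (Fin.last n, x) (Fin.last n, y)
    have h2 : star (s (2 * n) y x) = s (2 * n) x y := he.apply x y
    simp only [hankelMat, hankelKMat, Matrix.add_apply, Matrix.smul_apply, Matrix.of_apply,
      Fin.val_last, ← two_mul, smul_eq_mul, star_add, star_mul', h2, star_neg] at h1
    rw [Complex.star_def, Complex.conj_ofReal] at h1
    exact add_left_cancel h1

/-- Theorem 6.16(a): the first α-Schur transform of a sequence in K^{≥}_{q,κ,α}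
    belongs to K^{≥}_{q,κ−1,α}. -/
theorem stmt11 {q : ℕ} (α : ℝ) (κ : ℕ∞) (hκ : 1 ≤ κ)
    (s : ℕ → Matrix (Fin q) (Fin q) ℂ) (hs : Kgg α κ s) :
    Kgg α (κ - 1) (schur1 (α : ℂ) s) := by
  have hle : ∀ {m : ℕ}, (m : ℕ∞) ≤ κ - 1 → ((m + 1 : ℕ) : ℕ∞) ≤ κ := by
    intro m hm
    push_cast
    exact (add_le_add_left hm 1).trans_eq (tsub_add_cancel_of_le hκ)
  have hs0 : (s 0).IsHermitian := hs.isHermitian (by simp)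
  have hMP := isMP_mp_of_isHermitian hs0
  have hcomm := hMP.commute_of_isHermitian hs0
  obtain ⟨P, hP⟩ : ∃ P, P = s 0 * mp (s 0) := ⟨_, rfl⟩
  have hPH : P.IsHermitian := by rw [hP]; exact hMP.2.2.1
  have hPm : P * mp (s 0) = mp (s 0) := by rw [hP, hcomm]; exact hMP.2.1
  have hmP : mp (s 0) * P = mp (s 0) := by rw [hP, ← mul_assoc]; exact hMP.2.1
  have hPs : P * s 0 = s 0 := by rw [hP]; exact hMP.1
  have hsP : s 0 * P = s 0 := by rw [hP, hcomm, ← mul_assoc]; exact hMP.1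
  have hPP : P * P = P := by
    nth_rw 2 [hP]
    rw [← mul_assoc, hPs, ← hP]
  classical
  obtain ⟨u, hu⟩ : ∃ u : ℕ → Matrix (Fin q) (Fin q) ℂ,
      ∀ j, u j = if (j : ℕ∞) ≤ κ then P * s j * P else 0 := ⟨_, fun _ => rfl⟩
  have hu' : ∀ j : ℕ, (j : ℕ∞) ≤ κ → u j = P * s j * P := fun j hj => by rw [hu, if_pos hj]
  have hu0 : u 0 = s 0 := by rw [hu' 0 (by simp), hPs, hsP]
  have huH : ∀ j, (u j).IsHermitian := by
    intro j
    rw [hu]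
    split_ifs with hj
    · rw [Matrix.IsHermitian, conjTranspose_mul, conjTranspose_mul, hPH.eq,
        (hs.isHermitian hj).eq, mul_assoc]
    · exact Matrix.isHermitian_zero
  have hPu : ∀ j, P * u j = u j := by
    intro j
    rw [hu]
    split_ifs
    · rw [← mul_assoc, ← mul_assoc, hPP]
    · simp
  set t := shiftA (α : ℂ) u with ht
  set W := recip t with hW
  have ht0 : t 0 = s 0 := by rw [ht, shiftA, hu0]
  have htH : ∀ j, (t j).IsHermitian := shiftA_isHermitian huH
  have hPW : ∀ j, P * W j = W j := mul_recip (by rw [ht0, hPm])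
  have hWP : ∀ j, W j * P = W j := recip_mul (by rw [ht0, hmP])
  have htW : PowerSeries.mk t * PowerSeries.mk W = PowerSeries.C P :=
    mk_mul_mk_recip (mul_shiftA _ hPu) (by rw [ht0, hP])
  have hWH : ∀ j, (W j).IsHermitian := isHermitian_of_mk_mul_mk htH hPH hPW htW
  have hWt := mk_mul_mk_comm_of_isHermitian htH hWH hPH htW
  set V := shiftA (α : ℂ) W with hV
  have hVH : ∀ j, (V j).IsHermitian := shiftA_isHermitian hWH
  have hPV : ∀ j, P * V j = V j := mul_shiftA _ hPW
  have hVP : ∀ j, V j * P = V j := shiftA_mul _ hWP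
  have huV : PowerSeries.mk u * PowerSeries.mk V = PowerSeries.C P := by
    rw [hV, ← mk_shiftA_mul, ← ht, htW]
  have hVu := mk_mul_mk_comm_of_isHermitian huH hVH hPH huV
  have htc : ∀ j : ℕ, (j : ℕ∞) ≤ κ → t j = P * shiftA (α : ℂ) s j * P := by
    intro j hj
    cases j with
    | zero => rw [ht0, shiftA, hPs, hsP]
    | succ j =>
      rw [ht, shiftA, shiftA, hu' _ hj, hu' j (le_trans (by exact_mod_cast Nat.le_succ _) hj)]
      simp only [mul_add, add_mul, mul_smul_comm, smul_mul_assoc]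
  have hschur : ∀ j : ℕ, ((j + 1 : ℕ) : ℕ∞) ≤ κ →
      schur1 (α : ℂ) s j = -(s 0 * W (j + 1) * s 0) := by
    intro j hj
    rw [schur1, recipA, hW, recip_congr_of_compress (t := shiftA (α : ℂ) s) (P := P) (N := j + 1)
      hPm hmP ht0 (fun i hi => htc i (le_trans (by exact_mod_cast hi) hj)) le_rfl]
    simp
  have hcompress : ∀ {Z g v : ℕ → Matrix (Fin q) (Fin q) ℂ} {m N : ℕ},
      (∀ j, (Z j).IsHermitian) → (∀ j, P * Z j = Z j) → (∀ j, Z j * P = Z j) →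
      (∀ i ≤ m + N, v i = P * g i * P) →
      ∑ a ∈ Finset.range (m + 1), ∑ b ∈ Finset.range (N + 1),
        (s 0 * Z (m - a)) * g (a + b) * (s 0 * Z (N - b))ᴴ =
      s 0 * (∑ a ∈ Finset.range (m + 1), ∑ b ∈ Finset.range (N + 1),
        Z (m - a) * v (a + b) * Z (N - b)) * s 0 := by
    intro Z g v m N hZ hPZ hZP hv
    simp only [Finset.mul_sum, Finset.sum_mul]
    refine Finset.sum_congr rfl fun a ha => Finset.sum_congr rfl fun b hb => ?_
    rw [Finset.mem_range] at ha hb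
    rw [conjTranspose_mul, hs0.eq, (hZ _).eq, hv (a + b) (by omega)]
    calc _ = s 0 * (Z (m - a) * g (a + b) * Z (N - b)) * s 0 := by simp only [mul_assoc]
      _ = s 0 * ((Z (m - a) * P) * g (a + b) * (P * Z (N - b))) * s 0 := by rw [hZP, hPZ]
      _ = _ := by simp only [mul_assoc]
  refine ⟨fun n hn => ?_, fun n hn => ?_⟩
  · have hn1 := hle hn
    have hH : (hankelMat (fun i => shiftA (α : ℂ) s (i + 1)) (n + 0)).PosSemidef := hs.2 n hn1
    convert posSemidef_toeplitz_congr (Z := fun i => s 0 * W i) (d := 0) hH using 1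
    ext ⟨j, x⟩ ⟨k, y⟩
    have hj := j.isLt
    have hk := k.isLt
    have hi : ∀ i ≤ 2 * n + 1, (i : ℕ∞) ≤ κ := fun i hi => le_trans (by exact_mod_cast hi) hn1
    simp only [hankelMat, Matrix.of_apply, add_zero]
    rw [hcompress (v := fun i => t (i + 1)) hWH hPW hWP (fun i h => htc _ (hi _ (by omega))),
      sum_hankel_succ (conv_left hWt) (conv_right htW), hschur _ (hi _ (by omega)), hPW]
    simp
  · have hn1 := hle hn
    have hH : (hankelMat s (n + 1)).PosSemidef := hs.1 (n + 1) hn1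
    convert posSemidef_toeplitz_congr (Z := fun i => s 0 * V i) (d := 1) hH using 1
    ext ⟨j, x⟩ ⟨k, y⟩
    have hj := j.isLt
    have hk := k.isLt
    have hi : ∀ i ≤ 2 * n + 1 + 1, (i : ℕ∞) ≤ κ :=
      fun i hi => le_trans (by exact_mod_cast hi) hn1
    simp only [hankelMat, hankelKMat, Matrix.add_apply, Matrix.smul_apply, Matrix.of_apply]
    rw [hcompress (v := u) hVH hPV hVP (fun i h => hu' _ (hi _ (by omega))),
      sum_hankel (conv_left hVu) (conv_right huV), hschur _ (hi _ (by omega)),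
      hschur _ (hi _ (by omega)), hPV, hV, shiftA, ← Matrix.smul_apply, ← Matrix.add_apply]
    simp only [mul_neg, neg_mul, mul_add, add_mul, mul_smul_comm, smul_mul_assoc]
    simp [add_comm]
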